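/- arXiv:2409.20427 — 6 statements merged into one kernel-verified Lean document; each statement's English description precedes it below -/
import Mathlib

section
/- Let 0 ≤ ε < ρ(f(x), f_∅(x))/2. If S_suf ⊆ Fin d is ε-super-sufficient and S_nec ⊆ Fin d is ε-necessary, then S_suf ∩ S_nec ≠ ∅. -/
open MeasureTheory

/-- Average restricted prediction `f_S(x) = ∫ f(x_S, z_{S^c}) dν_S(z)`. -/
noncomputable def avgPred (d : ℕ) (f : (Fin d → ℝ) → ℝ) (x : Fin d → ℝ)
    (ν : Finset (Fin d) → Measure (Fin d → ℝ)) (S : Finset (Fin d)) : ℝ :=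
  ∫ z, f (S.piecewise x z) ∂(ν S)

/-- `Δsuf(S) = ρ(f(x), f_S(x))`. -/
noncomputable def deltaSuf (d : ℕ) (f : (Fin d → ℝ) → ℝ) (x : Fin d → ℝ)
    (ν : Finset (Fin d) → Measure (Fin d → ℝ)) (ρ : ℝ → ℝ → ℝ)
    (S : Finset (Fin d)) : ℝ :=
  ρ (f x) (avgPred d f x ν S)

/-- `Δnec(S) = ρ(f_{S^c}(x), f_∅(x))`. -/
noncomputable def deltaNec (d : ℕ) (f : (Fin d → ℝ) → ℝ) (x : Fin d → ℝ)
    (ν : Finset (Fin d) → Measure (Fin d → ℝ)) (ρ : ℝ → ℝ → ℝ)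
    (S : Finset (Fin d)) : ℝ :=
  ρ (avgPred d f x ν Sᶜ) (avgPred d f x ν (∅ : Finset (Fin d)))

/-- `Δuni(S, α) = α·Δsuf(S) + (1-α)·Δnec(S)`. -/
noncomputable def deltaUni (d : ℕ) (f : (Fin d → ℝ) → ℝ) (x : Fin d → ℝ)
    (ν : Finset (Fin d) → Measure (Fin d → ℝ)) (ρ : ℝ → ℝ → ℝ)
    (α : ℝ) (S : Finset (Fin d)) : ℝ :=
  α * deltaSuf d f x ν ρ S + (1 - α) * deltaNec d f x ν ρ S

/-- `S` is ε-sufficient. -/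
def IsSufficient (d : ℕ) (f : (Fin d → ℝ) → ℝ) (x : Fin d → ℝ)
    (ν : Finset (Fin d) → Measure (Fin d → ℝ)) (ρ : ℝ → ℝ → ℝ)
    (ε : ℝ) (S : Finset (Fin d)) : Prop :=
  deltaSuf d f x ν ρ S ≤ ε

/-- `S` is ε-super-sufficient: every superset of `S` (including `S`) is ε-sufficient. -/
def IsSuperSufficient (d : ℕ) (f : (Fin d → ℝ) → ℝ) (x : Fin d → ℝ)
    (ν : Finset (Fin d) → Measure (Fin d → ℝ)) (ρ : ℝ → ℝ → ℝ)
    (ε : ℝ) (S : Finset (Fin d)) : Prop :=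
  ∀ T : Finset (Fin d), S ⊆ T → deltaSuf d f x ν ρ T ≤ ε

/-- `S` is ε-necessary. -/
def IsNecessary (d : ℕ) (f : (Fin d → ℝ) → ℝ) (x : Fin d → ℝ)
    (ν : Finset (Fin d) → Measure (Fin d → ℝ)) (ρ : ℝ → ℝ → ℝ)
    (ε : ℝ) (S : Finset (Fin d)) : Prop :=
  deltaNec d f x ν ρ S ≤ ε

/-- `S` is ε-super-necessary: every superset of `S` (including `S`) is ε-necessary. -/
def IsSuperNecessary (d : ℕ) (f : (Fin d → ℝ) → ℝ) (x : Fin d → ℝ)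
    (ν : Finset (Fin d) → Measure (Fin d → ℝ)) (ρ : ℝ → ℝ → ℝ)
    (ε : ℝ) (S : Finset (Fin d)) : Prop :=
  ∀ T : Finset (Fin d), S ⊆ T → deltaNec d f x ν ρ T ≤ ε

/-- If `0 ≤ ε < ρ(f(x), f_∅(x))/2`, `S_suf` is ε-super-sufficient and
`S_nec` is ε-necessary, then `S_suf ∩ S_nec ≠ ∅`. -/
theorem superSufficient_inter_necessary_nonempty
    (d : ℕ) (f : (Fin d → ℝ) → ℝ) (x : Fin d → ℝ)
    (ν : Finset (Fin d) → Measure (Fin d → ℝ))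
    (hν : ∀ S : Finset (Fin d), IsProbabilityMeasure (ν S))
    (hint : ∀ S : Finset (Fin d), Integrable (fun z => f (S.piecewise x z)) (ν S))
    (ρ : ℝ → ℝ → ℝ)
    (hρ_nonneg : ∀ a b : ℝ, 0 ≤ ρ a b)
    (hρ_eq : ∀ a b : ℝ, ρ a b = 0 ↔ a = b)
    (hρ_symm : ∀ a b : ℝ, ρ a b = ρ b a)
    (hρ_tri : ∀ a b c : ℝ, ρ a c ≤ ρ a b + ρ b c)
    (ε : ℝ) (hε : 0 ≤ ε)
    (hε' : ε < ρ (f x) (avgPred d f x ν (∅ : Finset (Fin d))) / 2)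
    (Ssuf Snec : Finset (Fin d))
    (hsuf : IsSuperSufficient d f x ν ρ ε Ssuf)
    (hnec : IsNecessary d f x ν ρ ε Snec) :
    Ssuf ∩ Snec ≠ ∅ := by
  intro h
  have hsub : Ssuf ⊆ Snecᶜ :=
    Finset.subset_compl_iff_disjoint_right.mpr (Finset.disjoint_iff_inter_eq_empty.mpr h)
  have hs : ρ (f x) (avgPred d f x ν Snecᶜ) ≤ ε := hsuf _ hsub
  have hn : ρ (avgPred d f x ν Snecᶜ) (avgPred d f x ν ∅) ≤ ε := hnec
  linarith [hρ_tri (f x) (avgPred d f x ν Snecᶜ) (avgPred d f x ν ∅)]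
end

section
/- Let 0 ≤ ε < ρ(f(x), f_∅(x))/2. If S_suf ⊆ Fin d is ε-sufficient and S_nec ⊆ Fin d is ε-super-necessary, then S_suf ∩ S_nec ≠ ∅. -/
open MeasureTheory

/-- If `0 ≤ ε < ρ(f(x), f_∅(x))/2`, `S_suf` is ε-sufficient and
`S_nec` is ε-super-necessary, then `S_suf ∩ S_nec ≠ ∅`. -/
theorem sufficient_inter_superNecessary_nonempty
    (d : ℕ) (f : (Fin d → ℝ) → ℝ) (x : Fin d → ℝ)
    (ν : Finset (Fin d) → Measure (Fin d → ℝ))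
    (hν : ∀ S : Finset (Fin d), IsProbabilityMeasure (ν S))
    (hint : ∀ S : Finset (Fin d), Integrable (fun z => f (S.piecewise x z)) (ν S))
    (ρ : ℝ → ℝ → ℝ)
    (hρ_nonneg : ∀ a b : ℝ, 0 ≤ ρ a b)
    (hρ_eq : ∀ a b : ℝ, ρ a b = 0 ↔ a = b)
    (hρ_symm : ∀ a b : ℝ, ρ a b = ρ b a)
    (hρ_tri : ∀ a b c : ℝ, ρ a c ≤ ρ a b + ρ b c)
    (ε : ℝ) (hε : 0 ≤ ε)
    (hε' : ε < ρ (f x) (avgPred d f x ν (∅ : Finset (Fin d))) / 2)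
    (Ssuf Snec : Finset (Fin d))
    (hsuf : IsSufficient d f x ν ρ ε Ssuf)
    (hnec : IsSuperNecessary d f x ν ρ ε Snec) :
    Ssuf ∩ Snec ≠ ∅ := by
  intro hdisj
  have hsub : Snec ⊆ Ssufᶜ :=
    Finset.subset_compl_iff_disjoint_left.mpr (Finset.disjoint_iff_inter_eq_empty.mpr hdisj)
  have hS := hnec Ssufᶜ hsub
  rw [deltaNec, compl_compl] at hS
  rw [IsSufficient, deltaSuf] at hsuf
  linarith [hρ_tri (f x) (avgPred d f x ν Ssuf) (avgPred d f x ν ∅)]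
end

section
/- Let ε ≥ 0. If S_suf ⊆ Fin d is ε-super-sufficient, S_nec ⊆ Fin d is ε-necessary, and S_suf ∩ S_nec = ∅, then ρ(f(x), f_∅(x)) ≤ 2ε. -/
open MeasureTheory

/-- If `S_suf` is ε-super-sufficient, `S_nec` is ε-necessary and they are
disjoint, then `ρ(f(x), f_∅(x)) ≤ 2ε`. -/
theorem disjoint_superSufficient_necessary_bound
    (d : ℕ) (f : (Fin d → ℝ) → ℝ) (x : Fin d → ℝ)
    (ν : Finset (Fin d) → Measure (Fin d → ℝ))
    (hν : ∀ S : Finset (Fin d), IsProbabilityMeasure (ν S))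
    (hint : ∀ S : Finset (Fin d), Integrable (fun z => f (S.piecewise x z)) (ν S))
    (ρ : ℝ → ℝ → ℝ)
    (hρ_nonneg : ∀ a b : ℝ, 0 ≤ ρ a b)
    (hρ_eq : ∀ a b : ℝ, ρ a b = 0 ↔ a = b)
    (hρ_symm : ∀ a b : ℝ, ρ a b = ρ b a)
    (hρ_tri : ∀ a b c : ℝ, ρ a c ≤ ρ a b + ρ b c)
    (ε : ℝ) (hε : 0 ≤ ε)
    (Ssuf Snec : Finset (Fin d))
    (hsuf : IsSuperSufficient d f x ν ρ ε Ssuf)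
    (hnec : IsNecessary d f x ν ρ ε Snec)
    (hdisj : Ssuf ∩ Snec = ∅) :
    ρ (f x) (avgPred d f x ν (∅ : Finset (Fin d))) ≤ 2 * ε := by
  have hsub : Ssuf ⊆ Snecᶜ :=
    Finset.subset_compl_iff_disjoint_right.mpr (Finset.disjoint_iff_inter_eq_empty.mpr hdisj)
  calc ρ (f x) (avgPred d f x ν ∅)
      ≤ deltaSuf d f x ν ρ Snecᶜ + deltaNec d f x ν ρ Snec := hρ_tri _ _ _
    _ ≤ ε + ε := add_le_add (hsuf _ hsub) hnec
    _ = 2 * ε := (two_mul ε).symm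
end

section
/- Let τ₁, τ₂ ≥ 1 and 0 ≤ ε < ρ(f(x), f_∅(x))/2. Suppose S_suf ⊆ Fin d is ε-super-sufficient with |S_suf| = τ₁ and S_nec ⊆ Fin d is ε-super-necessary with |S_nec| = τ₂. Then there exists a subset S* ⊆ Fin d (one may take S* = S_suf ∪ S_nec) such that Δuni(S*, α) ≤ ε for every α ∈ [0,1], and max(τ₁, τ₂) ≤ |S*| < τ₁ + τ₂. -/
open MeasureTheory

/-- Under ε-super-sufficiency of `S_suf` (of size τ₁) and ε-super-necessity of
`S_nec` (of size τ₂), there is a set `S*` with `Δuni(S*, α) ≤ ε` for every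
`α ∈ [0,1]` and `max(τ₁, τ₂) ≤ |S*| < τ₁ + τ₂`. -/
theorem exists_unified_solution
    (d : ℕ) (f : (Fin d → ℝ) → ℝ) (x : Fin d → ℝ)
    (ν : Finset (Fin d) → Measure (Fin d → ℝ))
    (hν : ∀ S : Finset (Fin d), IsProbabilityMeasure (ν S))
    (hint : ∀ S : Finset (Fin d), Integrable (fun z => f (S.piecewise x z)) (ν S))
    (ρ : ℝ → ℝ → ℝ)
    (hρ_nonneg : ∀ a b : ℝ, 0 ≤ ρ a b)
    (hρ_eq : ∀ a b : ℝ, ρ a b = 0 ↔ a = b)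
    (hρ_symm : ∀ a b : ℝ, ρ a b = ρ b a)
    (hρ_tri : ∀ a b c : ℝ, ρ a c ≤ ρ a b + ρ b c)
    (τ₁ τ₂ : ℕ) (hτ₁ : 1 ≤ τ₁) (hτ₂ : 1 ≤ τ₂)
    (ε : ℝ) (hε : 0 ≤ ε)
    (hε' : ε < ρ (f x) (avgPred d f x ν (∅ : Finset (Fin d))) / 2)
    (Ssuf Snec : Finset (Fin d))
    (hsuf : IsSuperSufficient d f x ν ρ ε Ssuf) (hcard₁ : Ssuf.card = τ₁)
    (hnec : IsSuperNecessary d f x ν ρ ε Snec) (hcard₂ : Snec.card = τ₂) :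
    ∃ S : Finset (Fin d),
      (∀ α ∈ Set.Icc (0 : ℝ) 1, deltaUni d f x ν ρ α S ≤ ε) ∧
      max τ₁ τ₂ ≤ S.card ∧ S.card < τ₁ + τ₂ := by
  subst hcard₁ hcard₂
  refine ⟨Ssuf ∪ Snec, ?_, ?_, ?_⟩
  · rintro α ⟨h0, h1⟩
    have hs := hsuf _ (Finset.subset_union_left (s₂ := Snec))
    have hn := hnec _ (Finset.subset_union_right (s₁ := Ssuf))
    unfold deltaUni
    linarith [mul_le_mul_of_nonneg_left hs h0, mul_le_mul_of_nonneg_left hn (sub_nonneg.2 h1)]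
  · exact max_le (Finset.card_le_card Finset.subset_union_left)
      (Finset.card_le_card Finset.subset_union_right)
  · refine lt_of_le_of_ne (Finset.card_union_le _ _) fun h => ?_
    have hdisj : Disjoint Ssuf Snec := Finset.card_union_eq_card_add_card.1 h
    have hs := hsuf Snecᶜ (Finset.subset_compl_iff_disjoint_right.2 hdisj)
    have hn := hnec Snec subset_rfl
    unfold deltaSuf at hs
    unfold deltaNec at hn
    linarith [hρ_tri (f x) (avgPred d f x ν Snecᶜ) (avgPred d f x ν ∅)]
end

section
/- Suppose f(x) ≠ f_∅(x). Partition the feature set [d] into the two players S and Sᶜ, define the characteristic function v(T) := −ρ(f(x), f_T(x)) for T ∈ {∅, S, Sᶜ, [d]}, and define the two-player Shapley value of player S as φ_S := (1/2)·(v([d]) − v(Sᶜ)) + (1/2)·(v(S) − v(∅)). Then φ_S ≥ ρ(f(x), f_∅(x)) − Δuni(S, 1/2), i.e., φ_S ≥ ρ(f(x), f_∅(x)) − (1/2)·ρ(f(x), f_S(x)) − (1/2)·ρ(f_{Sᶜ}(x), f_∅(x)). -/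
open MeasureTheory

/-- Two-player characteristic function `v(T) = -ρ(f(x), f_T(x))`. -/
noncomputable def charFun (d : ℕ) (f : (Fin d → ℝ) → ℝ) (x : Fin d → ℝ)
    (ν : Finset (Fin d) → Measure (Fin d → ℝ)) (ρ : ℝ → ℝ → ℝ)
    (T : Finset (Fin d)) : ℝ :=
  -(ρ (f x) (avgPred d f x ν T))

/-- Two-player Shapley value of the player `S` in the partition `{S, Sᶜ}` of `[d]`:
`φ_S = (1/2)·(v([d]) − v(Sᶜ)) + (1/2)·(v(S) − v(∅))`. -/
noncomputable def shapTwoPlayer (d : ℕ) (f : (Fin d → ℝ) → ℝ) (x : Fin d → ℝ)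
    (ν : Finset (Fin d) → Measure (Fin d → ℝ)) (ρ : ℝ → ℝ → ℝ)
    (S : Finset (Fin d)) : ℝ :=
  (1 / 2) * (charFun d f x ν ρ (Finset.univ : Finset (Fin d)) - charFun d f x ν ρ Sᶜ)
    + (1 / 2) * (charFun d f x ν ρ S - charFun d f x ν ρ (∅ : Finset (Fin d)))

/-- Fixing every coordinate recovers the prediction: `f_{[d]}(x) = f(x)`. -/
theorem avgPred_univ (d : ℕ) (f : (Fin d → ℝ) → ℝ) (x : Fin d → ℝ)
    (ν : Finset (Fin d) → Measure (Fin d → ℝ)) [IsProbabilityMeasure (ν Finset.univ)] :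
    avgPred d f x ν Finset.univ = f x := by
  simp [avgPred]

/-- The two-player Shapley value of `S` is lower bounded by
`ρ(f(x), f_∅(x)) − Δuni(S, 1/2)`. -/
theorem shapley_lower_bound
    (d : ℕ) (f : (Fin d → ℝ) → ℝ) (x : Fin d → ℝ)
    (ν : Finset (Fin d) → Measure (Fin d → ℝ))
    (hν : ∀ S : Finset (Fin d), IsProbabilityMeasure (ν S))
    (hint : ∀ S : Finset (Fin d), Integrable (fun z => f (S.piecewise x z)) (ν S))
    (ρ : ℝ → ℝ → ℝ)
    (hρ_nonneg : ∀ a b : ℝ, 0 ≤ ρ a b)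
    (hρ_eq : ∀ a b : ℝ, ρ a b = 0 ↔ a = b)
    (hρ_symm : ∀ a b : ℝ, ρ a b = ρ b a)
    (hρ_tri : ∀ a b c : ℝ, ρ a c ≤ ρ a b + ρ b c)
    (hne : f x ≠ avgPred d f x ν (∅ : Finset (Fin d)))
    (S : Finset (Fin d)) :
    shapTwoPlayer d f x ν ρ S ≥
      ρ (f x) (avgPred d f x ν (∅ : Finset (Fin d)))
        - deltaUni d f x ν ρ (1 / 2) S := by
  have htri := hρ_tri (f x) (avgPred d f x ν Sᶜ) (avgPred d f x ν ∅)
  have huniv : ρ (f x) (avgPred d f x ν Finset.univ) = 0 := by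
    rw [avgPred_univ, hρ_eq]
  simp only [shapTwoPlayer, _root_.charFun, deltaUni, deltaSuf, deltaNec, huniv]
  linarith
end

section
/- Let α ∈ (0,1) and ε ≥ 0, and suppose the model is the regression function f(u) = E[Y | X = u] and every reference distribution ν_S is the conditional distribution of the coordinates outside S given X_S = x_S. If S* ⊆ Fin d satisfies Δuni(S*, α) = ε, then ρ(E[Y | X = x], E[Y | X_{S*} = x_{S*}]) ≤ ε/α and ρ(E[Y | X_{S*ᶜ} = x_{S*ᶜ}], E[Y]) ≤ ε/(1−α). -/
open MeasureTheory

/-- Product Lebesgue measure on the coordinates outside `S`, with the coordinates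
inside `S` pinned to `x` (via Dirac masses), as a measure on `Fin d → ℝ`. -/
noncomputable def lebOutside (d : ℕ) (x : Fin d → ℝ) (S : Finset (Fin d)) :
    Measure (Fin d → ℝ) :=
  Measure.pi (fun i => if i ∈ S then Measure.dirac (x i) else (volume : Measure ℝ))

/-- Feature-marginal density `q(u) = ∫ p(u, y) dy`. -/
noncomputable def margQ (d : ℕ) (p : (Fin d → ℝ) × ℝ → ℝ) (u : Fin d → ℝ) : ℝ :=
  ∫ y : ℝ, p (u, y)

/-- Regression function `f(u) = E[Y ∣ X = u] = (∫ y·p(u, y) dy) / q(u)`. -/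
noncomputable def regF (d : ℕ) (p : (Fin d → ℝ) × ℝ → ℝ) (u : Fin d → ℝ) : ℝ :=
  (∫ y : ℝ, y * p (u, y)) / margQ d p u

/-- `S`-marginal `q_S(x_S) = ∫ q(x_S, w_{S^c}) dw` over the coordinates outside `S`. -/
noncomputable def margQS (d : ℕ) (p : (Fin d → ℝ) × ℝ → ℝ) (x : Fin d → ℝ)
    (S : Finset (Fin d)) : ℝ :=
  ∫ w, margQ d p (S.piecewise x w) ∂(lebOutside d x S)

/-- Conditional reference distribution `ν_S`: the distribution of the coordinates
outside `S` given `X_S = x_S`, i.e. with density `w ↦ q(x_S, w_{S^c}) / q_S(x_S)`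
with respect to Lebesgue measure on the outside coordinates. -/
noncomputable def condNu (d : ℕ) (p : (Fin d → ℝ) × ℝ → ℝ) (x : Fin d → ℝ)
    (S : Finset (Fin d)) : Measure (Fin d → ℝ) :=
  (lebOutside d x S).withDensity
    (fun w => ENNReal.ofReal (margQ d p (S.piecewise x w) / margQS d p x S))

/-- Average restricted prediction `f_S(x) = ∫ f(x_S, w_{S^c}) dν_S(w)` with the
conditional reference distribution. -/
noncomputable def avgPredC (d : ℕ) (p : (Fin d → ℝ) × ℝ → ℝ) (x : Fin d → ℝ)
    (S : Finset (Fin d)) : ℝ :=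
  ∫ w, regF d p (S.piecewise x w) ∂(condNu d p x S)

/-- Conditional regression value `E[Y ∣ X_S = x_S] = (∫∫ y·p(x_S, w, y) dy dw) / q_S(x_S)`. -/
noncomputable def condEY (d : ℕ) (p : (Fin d → ℝ) × ℝ → ℝ) (x : Fin d → ℝ)
    (S : Finset (Fin d)) : ℝ :=
  (∫ w, (∫ y : ℝ, y * p (S.piecewise x w, y)) ∂(lebOutside d x S)) / margQS d p x S

/-- `E[Y] = ∫∫ y·p(u, y) du dy`. -/
noncomputable def expY (d : ℕ) (p : (Fin d → ℝ) × ℝ → ℝ) : ℝ :=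
  ∫ z : (Fin d → ℝ) × ℝ, z.2 * p z

/-- `Δsuf(S) = ρ(f(x), f_S(x))` for the regression model and conditional references. -/
noncomputable def deltaSufC (d : ℕ) (p : (Fin d → ℝ) × ℝ → ℝ) (x : Fin d → ℝ)
    (ρ : ℝ → ℝ → ℝ) (S : Finset (Fin d)) : ℝ :=
  ρ (regF d p x) (avgPredC d p x S)

/-- `Δnec(S) = ρ(f_{Sᶜ}(x), f_∅(x))` for the regression model and conditional references. -/
noncomputable def deltaNecC (d : ℕ) (p : (Fin d → ℝ) × ℝ → ℝ) (x : Fin d → ℝ)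
    (ρ : ℝ → ℝ → ℝ) (S : Finset (Fin d)) : ℝ :=
  ρ (avgPredC d p x Sᶜ) (avgPredC d p x (∅ : Finset (Fin d)))

/-- `Δuni(S, α) = α·Δsuf(S) + (1−α)·Δnec(S)`. -/
noncomputable def deltaUniC (d : ℕ) (p : (Fin d → ℝ) × ℝ → ℝ) (x : Fin d → ℝ)
    (ρ : ℝ → ℝ → ℝ) (α : ℝ) (S : Finset (Fin d)) : ℝ :=
  α * deltaSufC d p x ρ S + (1 - α) * deltaNecC d p x ρ S

lemma measurable_margQ {d : ℕ} {p : (Fin d → ℝ) × ℝ → ℝ} (hp : Measurable p) :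
    Measurable (margQ d p) :=
  hp.stronglyMeasurable.integral_prod_right'.measurable

lemma measurable_finset_piecewise_right {d : ℕ} (x : Fin d → ℝ) (S : Finset (Fin d)) :
    Measurable (fun w : Fin d → ℝ => S.piecewise x w) := by
  refine measurable_pi_lambda _ fun i => ?_
  by_cases hi : i ∈ S
  · simp [Finset.piecewise, hi]
  · simpa [Finset.piecewise, hi] using measurable_pi_apply i

/-- Averaging the regression function over the conditional reference distribution
gives the conditional expectation of the label. -/
lemma avgPredC_eq_condEY {d : ℕ} {x : Fin d → ℝ} {p : (Fin d → ℝ) × ℝ → ℝ}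
    (hp : Measurable p) (hq : ∀ u, 0 < margQ d p u) (S : Finset (Fin d))
    (hqS : 0 < margQS d p x S) :
    avgPredC d p x S = condEY d p x S := by
  have hmeas : Measurable fun w : Fin d → ℝ =>
      ENNReal.ofReal (margQ d p (S.piecewise x w) / margQS d p x S) :=
    (((measurable_margQ hp).comp (measurable_finset_piecewise_right x S)).div_const
      _).ennreal_ofReal
  unfold avgPredC condNu condEY
  rw [integral_withDensity_eq_integral_toReal_smul hmeas (by simp), ← integral_div]
  congr 1 with w
  have hw := hq (S.piecewise x w)
  rw [ENNReal.toReal_ofReal (div_pos hw hqS).le, smul_eq_mul, regF]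
  field_simp

lemma lebOutside_empty (d : ℕ) (x : Fin d → ℝ) : lebOutside d x ∅ = volume := by
  simp [lebOutside, volume_pi]

/-- Conditioning on no coordinate gives the plain expectation of the label. -/
lemma condEY_empty {d : ℕ} {x : Fin d → ℝ} {p : (Fin d → ℝ) × ℝ → ℝ}
    (hp : Measurable p) (hp_nonneg : ∀ z, 0 ≤ p z) (hp_one : ∫ z, p z = 1)
    (hp_int : Integrable fun z : (Fin d → ℝ) × ℝ => |z.2| * p z) :
    condEY d p x ∅ = expY d p := by
  have hint : Integrable p := .of_integral_ne_zero (by simp [hp_one])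
  have hint_mul : Integrable fun z : (Fin d → ℝ) × ℝ => z.2 * p z := by
    refine hp_int.mono' (measurable_snd.mul hp).aestronglyMeasurable (.of_forall fun z => ?_)
    rw [Real.norm_eq_abs, abs_mul, abs_of_nonneg (hp_nonneg z)]
  have hmass : margQS d p x ∅ = 1 := by
    rw [margQS, lebOutside_empty, ← hp_one, Measure.volume_eq_prod, integral_prod _ hint]
    simp [margQ]
  rw [condEY, hmass, lebOutside_empty, expY, Measure.volume_eq_prod,
    integral_prod _ hint_mul]
  simp

/-- Conditional-independence reading of the unified problem: if `Δuni(S*, α) = ε`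
for the regression model with conditional reference distributions, then
`ρ(E[Y ∣ X = x], E[Y ∣ X_{S*} = x_{S*}]) ≤ ε/α` and
`ρ(E[Y ∣ X_{S*ᶜ} = x_{S*ᶜ}], E[Y]) ≤ ε/(1−α)`. -/
theorem unified_conditional_independence
    (d : ℕ) (x : Fin d → ℝ) (p : (Fin d → ℝ) × ℝ → ℝ)
    (hp_meas : Measurable p)
    (hp_nonneg : ∀ z, 0 ≤ p z)
    (hp_one : ∫ z : (Fin d → ℝ) × ℝ, p z = 1)
    (hp_int : Integrable (fun z : (Fin d → ℝ) × ℝ => |z.2| * p z))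
    (hq_pos : ∀ u : Fin d → ℝ, 0 < margQ d p u)
    (hqS_pos : ∀ S : Finset (Fin d), 0 < margQS d p x S)
    (hFub : ∀ S : Finset (Fin d),
      Integrable (fun wy : (Fin d → ℝ) × ℝ => |wy.2| * p (S.piecewise x wy.1, wy.2))
        ((lebOutside d x S).prod volume))
    (ρ : ℝ → ℝ → ℝ)
    (hρ_nonneg : ∀ a b : ℝ, 0 ≤ ρ a b)
    (hρ_eq : ∀ a b : ℝ, ρ a b = 0 ↔ a = b)
    (hρ_symm : ∀ a b : ℝ, ρ a b = ρ b a)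
    (hρ_tri : ∀ a b c : ℝ, ρ a c ≤ ρ a b + ρ b c)
    (α ε : ℝ) (hα : α ∈ Set.Ioo (0 : ℝ) 1) (hε : 0 ≤ ε)
    (S : Finset (Fin d))
    (hS : deltaUniC d p x ρ α S = ε) :
    ρ (regF d p x) (condEY d p x S) ≤ ε / α ∧
      ρ (condEY d p x Sᶜ) (expY d p) ≤ ε / (1 - α) := by
  obtain ⟨hα0, hα1⟩ := hα
  rw [deltaUniC, deltaSufC, deltaNecC, avgPredC_eq_condEY hp_meas hq_pos S (hqS_pos S),
    avgPredC_eq_condEY hp_meas hq_pos Sᶜ (hqS_pos Sᶜ),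
    avgPredC_eq_condEY hp_meas hq_pos ∅ (hqS_pos ∅),
    condEY_empty hp_meas hp_nonneg hp_one hp_int] at hS
  have hsuf := mul_nonneg hα0.le (hρ_nonneg (regF d p x) (condEY d p x S))
  have hnec := mul_nonneg (sub_pos.2 hα1).le (hρ_nonneg (condEY d p x Sᶜ) (expY d p))
  rw [le_div_iff₀' hα0, le_div_iff₀' (sub_pos.2 hα1)]
  constructor <;> linarith
end
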